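/- Let A be a unital associative ℂ-algebra, N ≥ 1, and R : ℂ → ℂ → Matrix (Fin N × Fin N) (Fin N × Fin N) ℂ satisfying the Yang–Baxter equation and unitarity. Let a : ℂ → (Fin N → A) satisfy the ZF exchange relation for R, let T : ℂ → Matrix (Fin N) (Fin N) A satisfy the RTT relation for R, be well-bred for a, and have T(k) invertible for every k. Let B : ℂ → Matrix (Fin N) (Fin N) ℂ satisfy the scalar reflection equation for R with B(k)·B(−k) = I for all k, set b(k) := T(k)·B(k)·T(−k)⁻¹, and define ã(k) := (1/2)·(a(k) + b(k).mulVec (a(−k))). Then the boundary generators ã satisfy the same ZF exchange relation: ã(k₁)_i · ã(k₂)_j = Σ_{m,n} (R(k₂,k₁))₂₁_{(i,j),(m,n)} · ã(k₂)_n · ã(k₁)_m for all k₁, k₂ ∈ ℂ and i, j ∈ Fin N. -/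

import Mathlib

open Matrix

/-- `M₁ = M ⊗ I` on `ℂ^N ⊗ ℂ^N`. -/
def emb1 {N : ℕ} {A : Type*} [Semiring A] (M : Matrix (Fin N) (Fin N) A) :
    Matrix (Fin N × Fin N) (Fin N × Fin N) A :=
  fun p q => M p.1 q.1 * (if p.2 = q.2 then 1 else 0)

/-- `M₂ = I ⊗ M` on `ℂ^N ⊗ ℂ^N`. -/
def emb2 {N : ℕ} {A : Type*} [Semiring A] (M : Matrix (Fin N) (Fin N) A) :
    Matrix (Fin N × Fin N) (Fin N × Fin N) A :=
  fun p q => (if p.1 = q.1 then 1 else 0) * M p.2 q.2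

/-- `X₂₁`, with entries `(X₂₁)_{(a,b),(c,d)} = X_{(b,a),(d,c)}`. -/
def swap21 {N : ℕ} {A : Type*} (X : Matrix (Fin N × Fin N) (Fin N × Fin N) A) :
    Matrix (Fin N × Fin N) (Fin N × Fin N) A :=
  fun p q => X (p.2, p.1) (q.2, q.1)

/-- `X₁₂ = X ⊗ I` on `ℂ^N ⊗ ℂ^N ⊗ ℂ^N`. -/
def emb12 {N : ℕ} (X : Matrix (Fin N × Fin N) (Fin N × Fin N) ℂ) :
    Matrix (Fin N × Fin N × Fin N) (Fin N × Fin N × Fin N) ℂ :=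
  fun p q => X (p.1, p.2.1) (q.1, q.2.1) * (if p.2.2 = q.2.2 then 1 else 0)

/-- `X₁₃` on `ℂ^N ⊗ ℂ^N ⊗ ℂ^N`. -/
def emb13 {N : ℕ} (X : Matrix (Fin N × Fin N) (Fin N × Fin N) ℂ) :
    Matrix (Fin N × Fin N × Fin N) (Fin N × Fin N × Fin N) ℂ :=
  fun p q => X (p.1, p.2.2) (q.1, q.2.2) * (if p.2.1 = q.2.1 then 1 else 0)

/-- `X₂₃ = I ⊗ X` on `ℂ^N ⊗ ℂ^N ⊗ ℂ^N`. -/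
def emb23 {N : ℕ} (X : Matrix (Fin N × Fin N) (Fin N × Fin N) ℂ) :
    Matrix (Fin N × Fin N × Fin N) (Fin N × Fin N × Fin N) ℂ :=
  fun p q => (if p.1 = q.1 then 1 else 0) * X (p.2.1, p.2.2) (q.2.1, q.2.2)

section Embeddings

variable {N : ℕ} {A : Type*}

/-- The operator `u ↦ v ⊗ u`, as a matrix from `A^N` to `A^N ⊗ A^N`. -/
def col1 [Semiring A] (v : Fin N → A) : Matrix (Fin N × Fin N) (Fin N) A :=
  fun p q => v p.1 * (if p.2 = q then 1 else 0)

/-- The operator inserting `v` in the second tensor slot, with the entries of `v` on the left. -/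
def col2 [Semiring A] (v : Fin N → A) : Matrix (Fin N × Fin N) (Fin N) A :=
  fun p q => v p.2 * (if p.1 = q then 1 else 0)

theorem swap21_mul [Semiring A] (X Y : Matrix (Fin N × Fin N) (Fin N × Fin N) A) :
    swap21 (X * Y) = swap21 X * swap21 Y :=
  (submatrix_mul_equiv X Y Prod.swap (Equiv.prodComm _ _) Prod.swap).symm

theorem swap21_emb1 [Semiring A] (M : Matrix (Fin N) (Fin N) A) : swap21 (emb1 M) = emb2 M := by
  ext p q
  simp [swap21, emb1, emb2]

theorem swap21_emb2 [Semiring A] (M : Matrix (Fin N) (Fin N) A) : swap21 (emb2 M) = emb1 M := by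
  ext p q
  simp [swap21, emb1, emb2]

theorem swap21_one [Semiring A] :
    swap21 (1 : Matrix (Fin N × Fin N) (Fin N × Fin N) A) = 1 := by
  ext ⟨i, j⟩ ⟨k, l⟩
  simp [swap21, one_apply, and_comm]

theorem swap21_map {C : Type*} (f : A → C) (X : Matrix (Fin N × Fin N) (Fin N × Fin N) A) :
    swap21 (X.map f) = (swap21 X).map f := rfl

theorem mul_submatrix_swap [Semiring A] {n : Type*}
    (X : Matrix (Fin N × Fin N) (Fin N × Fin N) A) (Y : Matrix (Fin N × Fin N) n A) :
    (X * Y).submatrix Prod.swap id = swap21 X * Y.submatrix Prod.swap id :=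
  (submatrix_mul_equiv X Y Prod.swap (Equiv.prodComm _ _) id).symm

theorem col2_submatrix_swap [Semiring A] (v : Fin N → A) :
    (col2 v).submatrix Prod.swap id = col1 v := rfl

theorem emb1_mul [Semiring A] (M M' : Matrix (Fin N) (Fin N) A) :
    emb1 (M * M') = emb1 M * emb1 M' := by
  ext ⟨i, j⟩ ⟨k, l⟩
  simp only [emb1, mul_apply, Fintype.sum_prod_type]
  by_cases h : j = l <;> simp [h]

theorem emb2_mul [Semiring A] (M M' : Matrix (Fin N) (Fin N) A) :
    emb2 (M * M') = emb2 M * emb2 M' := by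
  rw [← swap21_emb1, emb1_mul, swap21_mul, swap21_emb1, swap21_emb1]

theorem emb1_one [Semiring A] : emb1 (1 : Matrix (Fin N) (Fin N) A) = 1 := by
  ext ⟨i, j⟩ ⟨k, l⟩
  by_cases h : j = l <;> simp [emb1, one_apply, h]

theorem emb2_one [Semiring A] : emb2 (1 : Matrix (Fin N) (Fin N) A) = 1 := by
  rw [← swap21_emb1, emb1_one, swap21_one]

theorem emb1_map_algebraMap [Ring A] [Algebra ℂ A] (M : Matrix (Fin N) (Fin N) ℂ) :
    (emb1 M).map (algebraMap ℂ A) = emb1 (M.map (algebraMap ℂ A)) := by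
  ext p q
  by_cases h : p.2 = q.2 <;> simp [emb1, h]

theorem emb2_map_algebraMap [Ring A] [Algebra ℂ A] (M : Matrix (Fin N) (Fin N) ℂ) :
    (emb2 M).map (algebraMap ℂ A) = emb2 (M.map (algebraMap ℂ A)) := by
  rw [← swap21_emb1, ← swap21_map, emb1_map_algebraMap, swap21_emb1]

theorem emb1_map_mul_emb2 [Ring A] [Algebra ℂ A] (M : Matrix (Fin N) (Fin N) ℂ)
    (M' : Matrix (Fin N) (Fin N) A) :
    emb1 (M.map (algebraMap ℂ A)) * emb2 M' = emb2 M' * emb1 (M.map (algebraMap ℂ A)) := by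
  ext ⟨i, j⟩ ⟨k, l⟩
  simp [emb1, emb2, mul_apply, Fintype.sum_prod_type, Algebra.commutes]

theorem emb2_map_mul_emb1 [Ring A] [Algebra ℂ A] (M : Matrix (Fin N) (Fin N) ℂ)
    (M' : Matrix (Fin N) (Fin N) A) :
    emb2 (M.map (algebraMap ℂ A)) * emb1 M' = emb1 M' * emb2 (M.map (algebraMap ℂ A)) := by
  simpa only [swap21_mul, swap21_emb1, swap21_emb2] using
    congrArg swap21 (emb1_map_mul_emb2 M M')

theorem emb1_map_mul_col2 [Ring A] [Algebra ℂ A] (M : Matrix (Fin N) (Fin N) ℂ) (v : Fin N → A) :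
    emb1 (M.map (algebraMap ℂ A)) * col2 v = col2 v * M.map (algebraMap ℂ A) := by
  ext ⟨i, j⟩ k
  simp [emb1, col2, mul_apply, Fintype.sum_prod_type, Algebra.commutes]

theorem col1_mulVec_apply [Semiring A] (v u : Fin N → A) (i j : Fin N) :
    (col1 v *ᵥ u) (i, j) = v i * u j := by
  simp [col1, mulVec, dotProduct]

theorem col2_mulVec_apply [Semiring A] (v u : Fin N → A) (i j : Fin N) :
    (col2 v *ᵥ u) (i, j) = v j * u i := by
  simp [col2, mulVec, dotProduct]

theorem col1_add [Semiring A] (v w : Fin N → A) : col1 (v + w) = col1 v + col1 w := by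
  ext p q
  simp only [col1, Pi.add_apply, add_mul, Matrix.add_apply]

theorem col2_add [Semiring A] (v w : Fin N → A) : col2 (v + w) = col2 v + col2 w := by
  ext p q
  simp only [col2, Pi.add_apply, add_mul, Matrix.add_apply]

theorem col1_smul [Ring A] [Algebra ℂ A] (c : ℂ) (v : Fin N → A) : col1 (c • v) = c • col1 v := by
  ext p q
  simp [col1]

theorem col2_smul [Ring A] [Algebra ℂ A] (c : ℂ) (v : Fin N → A) : col2 (c • v) = c • col2 v := by
  ext p q
  simp [col2]

theorem col1_mulVec [Semiring A] (M : Matrix (Fin N) (Fin N) A) (v : Fin N → A) :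
    col1 (M *ᵥ v) = emb1 M * col1 v := by
  ext ⟨i, j⟩ k
  by_cases h : j = k <;>
    simp [col1, emb1, mul_apply, mulVec, dotProduct, Fintype.sum_prod_type, h]

theorem col2_mulVec [Semiring A] (M : Matrix (Fin N) (Fin N) A) (v : Fin N → A) :
    col2 (M *ᵥ v) = emb2 M * col2 v := by
  ext ⟨i, j⟩ k
  by_cases h : i = k <;>
    simp [col2, emb2, mul_apply, mulVec, dotProduct, Fintype.sum_prod_type, h]

theorem map_mulVec_apply [Ring A] [Algebra ℂ A]
    (X : Matrix (Fin N × Fin N) (Fin N × Fin N) ℂ) (w : Fin N × Fin N → A) (p : Fin N × Fin N) :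
    (X.map (algebraMap ℂ A) *ᵥ w) p = ∑ m : Fin N, ∑ n : Fin N, X p (m, n) • w (m, n) := by
  simp [mulVec, dotProduct, Fintype.sum_prod_type, Algebra.smul_def]

end Embeddings

/-- Dressing a solution of the reflection equation by a solution of the RTT relation, written in
an arbitrary monoid: `T₁ B₁ S₁` and `T₂ B₂ S₂` satisfy the reflection equation. Here `Sᵢ` is the
inverse of `Uᵢ`. -/
theorem dressed_reflection {M : Type*} [Monoid M]
    {r s r' s' T₁ T₂ U₁ U₂ S₁ S₂ B₁ B₂ : M}
    (h₁ : U₁ * S₁ = 1) (h₁' : S₁ * U₁ = 1) (h₂ : U₂ * S₂ = 1) (h₂' : S₂ * U₂ = 1)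
    (hr : r * T₁ * T₂ = T₂ * T₁ * r)
    (hs : s * T₂ * U₁ = U₁ * T₂ * s)
    (hr' : r' * T₁ * U₂ = U₂ * T₁ * r')
    (hs' : s' * U₂ * U₁ = U₁ * U₂ * s')
    (hBT₁ : B₂ * T₁ = T₁ * B₂) (hBT₂ : B₁ * T₂ = T₂ * B₁)
    (hBS₁ : B₂ * S₁ = S₁ * B₂) (hBS₂ : B₁ * S₂ = S₂ * B₁)
    (hB : r * B₁ * s * B₂ = B₂ * r' * B₁ * s') :
    r * (T₁ * B₁ * S₁) * s * (T₂ * B₂ * S₂) =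
      (T₂ * B₂ * S₂) * r' * (T₁ * B₁ * S₁) * s' := by
  have es : S₁ * s * T₂ = T₂ * s * S₁ := by
    calc S₁ * s * T₂ = S₁ * (s * T₂ * U₁) * S₁ := by simp only [mul_assoc, h₁, mul_one]
      _ = (S₁ * U₁) * T₂ * s * S₁ := by rw [hs]; simp only [mul_assoc]
      _ = _ := by rw [h₁', one_mul]
  have er' : S₂ * r' * T₁ = T₁ * r' * S₂ := by
    calc S₂ * r' * T₁ = S₂ * (r' * T₁ * U₂) * S₂ := by simp only [mul_assoc, h₂, mul_one]
      _ = (S₂ * U₂) * T₁ * r' * S₂ := by rw [hr']; simp only [mul_assoc]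
      _ = _ := by rw [h₂', one_mul]
  have es' : s' * S₁ * S₂ = S₂ * S₁ * s' := by
    calc s' * S₁ * S₂ = S₂ * (S₁ * U₁) * U₂ * s' * S₁ * S₂ := by
          rw [h₁', mul_one, h₂', one_mul]
      _ = S₂ * S₁ * (U₁ * U₂ * s') * S₁ * S₂ := by simp only [mul_assoc]
      _ = S₂ * S₁ * s' * U₂ * (U₁ * S₁) * S₂ := by rw [← hs']; simp only [mul_assoc]
      _ = S₂ * S₁ * s' * (U₂ * S₂) := by rw [h₁, mul_one, mul_assoc _ U₂]
      _ = _ := by rw [h₂, mul_one]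
  calc r * (T₁ * B₁ * S₁) * s * (T₂ * B₂ * S₂)
      = r * T₁ * B₁ * (S₁ * s * T₂) * B₂ * S₂ := by simp only [mul_assoc]
    _ = r * T₁ * (B₁ * T₂) * s * (S₁ * B₂) * S₂ := by rw [es]; simp only [mul_assoc]
    _ = (r * T₁ * T₂) * B₁ * s * B₂ * S₁ * S₂ := by
      rw [hBT₂, ← hBS₁]; simp only [mul_assoc]
    _ = T₂ * T₁ * (r * B₁ * s * B₂) * S₁ * S₂ := by rw [hr]; simp only [mul_assoc]
    _ = T₂ * (T₁ * B₂) * r' * B₁ * (s' * S₁ * S₂) := by rw [hB]; simp only [mul_assoc]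
    _ = T₂ * B₂ * T₁ * r' * (B₁ * S₂) * S₁ * s' := by
      rw [← hBT₁, es']; simp only [mul_assoc]
    _ = T₂ * B₂ * (T₁ * r' * S₂) * B₁ * S₁ * s' := by rw [hBS₂]; simp only [mul_assoc]
    _ = _ := by rw [← er']; simp only [mul_assoc]

/-- The boundary generators `ã(k) = ½(a(k) + b(k)a(−k))`, built from ZF generators `a`,
a well-bred RTT solution `T`, and a reflection matrix `B`, satisfy the same ZF exchange
relation as `a`. -/
theorem boundary_generators_ZF {A : Type*} [Ring A] [Algebra ℂ A]
    (N : ℕ) (hN : 1 ≤ N)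
    (R : ℂ → ℂ → Matrix (Fin N × Fin N) (Fin N × Fin N) ℂ)
    (hYBE : ∀ k₁ k₂ k₃ : ℂ,
      emb12 (R k₁ k₂) * emb13 (R k₁ k₃) * emb23 (R k₂ k₃) =
        emb23 (R k₂ k₃) * emb13 (R k₁ k₃) * emb12 (R k₁ k₂))
    (hUnit : ∀ k₁ k₂ : ℂ, R k₁ k₂ * swap21 (R k₂ k₁) = 1)
    (a : ℂ → Fin N → A)
    (hZF : ∀ (k₁ k₂ : ℂ) (i j : Fin N),
      a k₁ i * a k₂ j =
        ∑ m : Fin N, ∑ n : Fin N,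
          swap21 (R k₂ k₁) (i, j) (m, n) • (a k₂ n * a k₁ m))
    (T S : ℂ → Matrix (Fin N) (Fin N) A)
    (hTS : ∀ k, T k * S k = 1) (hST : ∀ k, S k * T k = 1)
    (hRTT : ∀ k₁ k₂ : ℂ,
      (R k₁ k₂).map (algebraMap ℂ A) * emb1 (T k₁) * emb2 (T k₂) =
        emb2 (T k₂) * emb1 (T k₁) * (R k₁ k₂).map (algebraMap ℂ A))
    (hwb : ∀ (k₁ k₂ : ℂ) (i j l : Fin N),
      T k₁ i l * a k₂ j =
        ∑ m : Fin N, ∑ n : Fin N,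
          swap21 (R k₂ k₁) (i, j) (m, n) • (a k₂ n * T k₁ m l))
    (B : ℂ → Matrix (Fin N) (Fin N) ℂ)
    (hBrefl : ∀ k₁ k₂ : ℂ,
      R k₁ k₂ * emb1 (B k₁) * swap21 (R k₂ (-k₁)) * emb2 (B k₂) =
        emb2 (B k₂) * R k₁ (-k₂) * emb1 (B k₁) * swap21 (R (-k₂) (-k₁)))
    (hBunit : ∀ k : ℂ, B k * B (-k) = 1)
    (b : ℂ → Matrix (Fin N) (Fin N) A)
    (hb : ∀ k, b k = T k * (B k).map (algebraMap ℂ A) * S (-k))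
    (ta : ℂ → Fin N → A)
    (hta : ∀ k : ℂ, ta k = (1/2 : ℂ) • (a k + (b k).mulVec (a (-k)))) :
    ∀ (k₁ k₂ : ℂ) (i j : Fin N),
      ta k₁ i * ta k₂ j =
        ∑ m : Fin N, ∑ n : Fin N,
          swap21 (R k₂ k₁) (i, j) (m, n) • (ta k₂ n * ta k₁ m) := by
  set ρ : ℂ → ℂ → Matrix (Fin N × Fin N) (Fin N × Fin N) A :=
    fun k₁ k₂ => (R k₁ k₂).map (algebraMap ℂ A) with hρ
  set σ : ℂ → ℂ → Matrix (Fin N × Fin N) (Fin N × Fin N) A :=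
    fun k₁ k₂ => (swap21 (R k₁ k₂)).map (algebraMap ℂ A) with hσ
  have swap_ρ : ∀ k₁ k₂, swap21 (ρ k₁ k₂) = σ k₁ k₂ := fun _ _ => rfl
  have swap_σ : ∀ k₁ k₂, swap21 (σ k₁ k₂) = ρ k₁ k₂ := fun _ _ => rfl
  have ρσ : ∀ k₁ k₂, ρ k₁ k₂ * σ k₂ k₁ = 1 := fun k₁ k₂ => by
    simp only [hρ, hσ]
    rw [← Matrix.map_mul, hUnit, Matrix.map_one _ (map_zero _) (map_one _)]
  have σρ : ∀ k₁ k₂, σ k₁ k₂ * ρ k₂ k₁ = 1 := fun k₁ k₂ => by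
    simpa only [swap21_mul, swap21_one, swap_ρ, swap_σ] using congrArg swap21 (ρσ k₁ k₂)
  have ZF : ∀ k₁ k₂, col1 (a k₁) *ᵥ a k₂ = σ k₂ k₁ *ᵥ (col2 (a k₂) *ᵥ a k₁) := fun k₁ k₂ => by
    funext ⟨i, j⟩
    simp only [hσ]
    rw [map_mulVec_apply, col1_mulVec_apply, hZF]
    simp only [col2_mulVec_apply]
  have wb : ∀ k₁ k₂, emb1 (T k₁) * col2 (a k₂) = σ k₂ k₁ * col2 (a k₂) * T k₁ := fun k₁ k₂ => by
    ext ⟨i, j⟩ l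
    have hl : (emb1 (T k₁) * col2 (a k₂)) (i, j) l = T k₁ i l * a k₂ j := by
      simp [emb1, col2, mul_apply, Fintype.sum_prod_type]
    rw [hl, hwb, Matrix.mul_assoc, mul_apply, Fintype.sum_prod_type]
    refine Finset.sum_congr rfl fun m _ => Finset.sum_congr rfl fun n _ => ?_
    simp [hσ, col2, mul_apply, Algebra.smul_def]
  have RTT : ∀ k₁ k₂, ρ k₁ k₂ * emb1 (T k₁) * emb2 (T k₂) =
      emb2 (T k₂) * emb1 (T k₁) * ρ k₁ k₂ := hRTT
  have RTT' : ∀ k₁ k₂, σ k₁ k₂ * emb2 (T k₁) * emb1 (T k₂) =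
      emb1 (T k₂) * emb2 (T k₁) * σ k₁ k₂ := fun k₁ k₂ => by
    simpa only [swap21_mul, swap21_emb1, swap21_emb2, swap_ρ] using congrArg swap21 (RTT k₁ k₂)
  have b_col2 : ∀ k₁ k₂, emb1 (b k₁) * σ k₂ (-k₁) * col2 (a k₂) =
      σ k₂ k₁ * col2 (a k₂) * b k₁ := fun k₁ k₂ => by
    have hS : emb1 (S (-k₁)) * σ k₂ (-k₁) * col2 (a k₂) = col2 (a k₂) * S (-k₁) := by
      calc emb1 (S (-k₁)) * σ k₂ (-k₁) * col2 (a k₂)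
          = emb1 (S (-k₁)) * (σ k₂ (-k₁) * col2 (a k₂) * T (-k₁)) * S (-k₁) := by
            simp only [Matrix.mul_assoc, hTS, Matrix.mul_one]
        _ = (emb1 (S (-k₁)) * emb1 (T (-k₁))) * col2 (a k₂) * S (-k₁) := by
            rw [← wb]; simp only [Matrix.mul_assoc]
        _ = _ := by rw [← emb1_mul, hST, emb1_one, Matrix.one_mul]
    calc emb1 (b k₁) * σ k₂ (-k₁) * col2 (a k₂)
        = emb1 (T k₁) * emb1 ((B k₁).map (algebraMap ℂ A)) *
            (emb1 (S (-k₁)) * σ k₂ (-k₁) * col2 (a k₂)) := by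
          rw [hb, emb1_mul, emb1_mul]; simp only [Matrix.mul_assoc]
      _ = emb1 (T k₁) * (emb1 ((B k₁).map (algebraMap ℂ A)) * col2 (a k₂)) * S (-k₁) := by
          rw [hS]; simp only [Matrix.mul_assoc]
      _ = (emb1 (T k₁) * col2 (a k₂)) * (B k₁).map (algebraMap ℂ A) * S (-k₁) := by
          rw [emb1_map_mul_col2]; simp only [Matrix.mul_assoc]
      _ = _ := by rw [wb, hb]; simp only [Matrix.mul_assoc]
  have b_col1 : ∀ k₁ k₂, emb2 (b k₂) * ρ k₁ (-k₂) * col1 (a k₁) =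
      ρ k₁ k₂ * col1 (a k₁) * b k₂ := fun k₁ k₂ => by
    have h := congrArg (fun X => X.submatrix Prod.swap id) (b_col2 k₂ k₁)
    simp only [Matrix.mul_assoc] at h ⊢
    simp only [mul_submatrix_swap, swap21_emb1, swap_σ, col2_submatrix_swap] at h
    exact h
  have refl_b : ∀ k₁ k₂, ρ k₁ k₂ * emb1 (b k₁) * σ k₂ (-k₁) * emb2 (b k₂) =
      emb2 (b k₂) * ρ k₁ (-k₂) * emb1 (b k₁) * σ (-k₂) (-k₁) := fun k₁ k₂ => by
    simp only [hb, emb1_mul, emb2_mul]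
    refine dressed_reflection (U₁ := emb1 (T (-k₁))) (U₂ := emb2 (T (-k₂)))
      ?_ ?_ ?_ ?_ (RTT _ _) (RTT' _ _) (RTT _ _) (RTT' _ _) (emb2_map_mul_emb1 _ _)
      (emb1_map_mul_emb2 _ _) (emb2_map_mul_emb1 _ _) (emb1_map_mul_emb2 _ _) ?_
    · rw [← emb1_mul, hTS, emb1_one]
    · rw [← emb1_mul, hST, emb1_one]
    · rw [← emb2_mul, hTS, emb2_one]
    · rw [← emb2_mul, hST, emb2_one]
    · have h := congrArg (fun X => X.map (algebraMap ℂ A)) (hBrefl k₁ k₂)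
      simpa only [Matrix.map_mul, emb1_map_algebraMap, emb2_map_algebraMap] using h
  have ba : ∀ k₁ k₂, col1 (b k₁ *ᵥ a (-k₁)) *ᵥ a k₂ =
      σ k₂ k₁ *ᵥ (col2 (a k₂) *ᵥ (b k₁ *ᵥ a (-k₁))) := fun k₁ k₂ => by
    rw [col1_mulVec, ← mulVec_mulVec, ZF]
    simp only [mulVec_mulVec, ← Matrix.mul_assoc, b_col2]
  have col1_b : ∀ k₁ k₂, col1 (a k₁) *ᵥ (b k₂ *ᵥ a (-k₂)) =
      σ k₂ k₁ *ᵥ (col2 (b k₂ *ᵥ a (-k₂)) *ᵥ a k₁) := fun k₁ k₂ => by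
    calc col1 (a k₁) *ᵥ (b k₂ *ᵥ a (-k₂))
        = σ k₂ k₁ *ᵥ ((ρ k₁ k₂ * col1 (a k₁) * b k₂) *ᵥ a (-k₂)) := by
          simp only [mulVec_mulVec, ← Matrix.mul_assoc, σρ, Matrix.one_mul]
      _ = (σ k₂ k₁ * emb2 (b k₂) * ρ k₁ (-k₂)) *ᵥ (col1 (a k₁) *ᵥ a (-k₂)) := by
          rw [← b_col1]; simp only [mulVec_mulVec, ← Matrix.mul_assoc]
      _ = (σ k₂ k₁ * emb2 (b k₂) * (ρ k₁ (-k₂) * σ (-k₂) k₁) * col2 (a (-k₂))) *ᵥ a k₁ := by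
          rw [ZF]; simp only [mulVec_mulVec, ← Matrix.mul_assoc]
      _ = _ := by
          rw [ρσ, Matrix.mul_one, col2_mulVec]; simp only [mulVec_mulVec, ← Matrix.mul_assoc]
  have bb : ∀ k₁ k₂, col1 (b k₁ *ᵥ a (-k₁)) *ᵥ (b k₂ *ᵥ a (-k₂)) =
      σ k₂ k₁ *ᵥ (col2 (b k₂ *ᵥ a (-k₂)) *ᵥ (b k₁ *ᵥ a (-k₁))) := fun k₁ k₂ => by
    have hba : col2 (a (-k₂)) *ᵥ (b k₁ *ᵥ a (-k₁)) =
        (ρ k₁ (-k₂) * emb1 (b k₁) * σ (-k₂) (-k₁)) *ᵥ (col2 (a (-k₂)) *ᵥ a (-k₁)) := by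
      calc col2 (a (-k₂)) *ᵥ (b k₁ *ᵥ a (-k₁))
          = ρ k₁ (-k₂) *ᵥ (σ (-k₂) k₁ *ᵥ (col2 (a (-k₂)) *ᵥ (b k₁ *ᵥ a (-k₁)))) := by
            rw [mulVec_mulVec _ (ρ _ _), ρσ, one_mulVec]
        _ = _ := by
            rw [← ba, col1_mulVec, ← mulVec_mulVec, ZF]
            simp only [mulVec_mulVec, ← Matrix.mul_assoc]
    calc col1 (b k₁ *ᵥ a (-k₁)) *ᵥ (b k₂ *ᵥ a (-k₂))
        = emb1 (b k₁) *ᵥ (col1 (a (-k₁)) *ᵥ (b k₂ *ᵥ a (-k₂))) := by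
          rw [col1_mulVec, ← mulVec_mulVec]
      _ = (emb1 (b k₁) * σ k₂ (-k₁) * emb2 (b k₂)) *ᵥ (col2 (a (-k₂)) *ᵥ a (-k₁)) := by
          rw [col1_b, col2_mulVec]; simp only [mulVec_mulVec, ← Matrix.mul_assoc]
      _ = (σ k₂ k₁ * (ρ k₁ k₂ * emb1 (b k₁) * σ k₂ (-k₁) * emb2 (b k₂))) *ᵥ
            (col2 (a (-k₂)) *ᵥ a (-k₁)) := by
          simp only [← Matrix.mul_assoc, σρ, Matrix.one_mul]
      _ = σ k₂ k₁ *ᵥ (emb2 (b k₂) *ᵥ (col2 (a (-k₂)) *ᵥ (b k₁ *ᵥ a (-k₁)))) := by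
          rw [refl_b, hba]; simp only [mulVec_mulVec, ← Matrix.mul_assoc]
      _ = _ := by rw [col2_mulVec, mulVec_mulVec _ (emb2 _)]
  have main : ∀ k₁ k₂, col1 (ta k₁) *ᵥ ta k₂ = σ k₂ k₁ *ᵥ (col2 (ta k₂) *ᵥ ta k₁) :=
    fun k₁ k₂ => by
      simp only [hta, col1_smul, col2_smul, col1_add, col2_add, smul_mulVec, mulVec_smul,
        add_mulVec, mulVec_add, smul_add, ZF k₁ k₂, ba, col1_b, bb]
      exact add_add_add_comm _ _ _ _
  intro k₁ k₂ i j
  have h := congrFun (main k₁ k₂) (i, j)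
  simp only [hσ] at h
  rw [map_mulVec_apply, col1_mulVec_apply] at h
  simpa only [col2_mulVec_apply] using h
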